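/- Let W_o, W_v, ΔW_o^{(i)}, ΔW_v^{(i)}, ΔW_o^{(j)}, ΔW_v^{(j)} be real d×d matrices, X a real d×e matrix, and A a real e-dimensional column vector. Define, for t ∈ {i, j}, M^{(t)} = W_o ΔW_v^{(t)} + ΔW_o^{(t)} W_v + ΔW_o^{(t)} ΔW_v^{(t)}, and the representation shifts ΔO^{(t)} = (W_o + ΔW_o^{(t)})(W_v + ΔW_v^{(t)}) X A − W_o W_v X A. If (M^{(i)})ᵀ M^{(j)} + (M^{(j)})ᵀ M^{(i)} = 0, then the Euclidean inner product of ΔO^{(i)} and ΔO^{(j)} is 0. -/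

import Mathlib

open Matrix

/-- If `Mᵀ * N + Nᵀ * M = 0`, then `M` and `N` send every vector to orthogonal vectors. -/
theorem mulVec_dotProduct_mulVec_eq_zero {m n : Type*} [Fintype m] [Fintype n]
    {M N : Matrix m n ℝ} (h : Mᵀ * N + Nᵀ * M = 0) (v : n → ℝ) :
    (M *ᵥ v) ⬝ᵥ (N *ᵥ v) = 0 := by
  have key (P Q : Matrix m n ℝ) : (P *ᵥ v) ⬝ᵥ (Q *ᵥ v) = v ⬝ᵥ ((Pᵀ * Q) *ᵥ v) := by
    rw [← mulVec_mulVec, dotProduct_mulVec v, vecMul_transpose]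
  have hsum : (M *ᵥ v) ⬝ᵥ (N *ᵥ v) + (N *ᵥ v) ⬝ᵥ (M *ᵥ v) = 0 := by
    rw [key M N, key N M, ← dotProduct_add, ← add_mulVec, h, zero_mulVec, dotProduct_zero]
  rw [dotProduct_comm (N *ᵥ v)] at hsum
  linarith

/-- The shift of the output `Wo * Wv * X *ᵥ A` under perturbations of `Wo` and `Wv` is linear in
`X *ᵥ A`. -/
theorem perturbed_mulVec_sub {l m n k R : Type*} [Fintype m] [Fintype n] [Fintype k] [Ring R]
    (Wo ΔWo : Matrix l m R) (Wv ΔWv : Matrix m n R) (X : Matrix n k R) (A : k → R) :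
    ((Wo + ΔWo) * (Wv + ΔWv) * X) *ᵥ A - (Wo * Wv * X) *ᵥ A =
      (Wo * ΔWv + ΔWo * Wv + ΔWo * ΔWv) *ᵥ (X *ᵥ A) := by
  rw [← sub_mulVec, ← Matrix.sub_mul, mulVec_mulVec]
  congr 2
  simp only [Matrix.add_mul, Matrix.mul_add]
  abel

theorem input_agnostic_lora_orthogonality {d e : ℕ}
    (Wo Wv ΔWoi ΔWvi ΔWoj ΔWvj : Matrix (Fin d) (Fin d) ℝ)
    (X : Matrix (Fin d) (Fin e) ℝ) (A : Fin e → ℝ)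
    (Mi : Matrix (Fin d) (Fin d) ℝ)
    (Mj : Matrix (Fin d) (Fin d) ℝ)
    (hMi : Mi = Wo * ΔWvi + ΔWoi * Wv + ΔWoi * ΔWvi)
    (hMj : Mj = Wo * ΔWvj + ΔWoj * Wv + ΔWoj * ΔWvj)
    (h : Miᵀ * Mj + Mjᵀ * Mi = 0) :
    (((Wo + ΔWoi) * (Wv + ΔWvi) * X).mulVec A - (Wo * Wv * X).mulVec A) ⬝ᵥ
      (((Wo + ΔWoj) * (Wv + ΔWvj) * X).mulVec A - (Wo * Wv * X).mulVec A) = 0 := by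
  subst hMi hMj
  rw [perturbed_mulVec_sub, perturbed_mulVec_sub]
  exact mulVec_dotProduct_mulVec_eq_zero h _
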